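/- Let P = {x ∈ ℝⁿ : ⟨a_i, x⟩ ≤ 1, 1 ≤ i ≤ m} be a centered simple n-dimensional polytope (irredundant description, 0 ∈ int P). Let F be a k-face of P with 1 ≤ k ≤ n − 1, and let A be the affine subspace spanned by the vectors a_i corresponding to all the facets of P that contain F. Then Σ_{i : a_i ∈ A} vol(C_i) = ((dim A + 1)/(n + 1)) · vol(P) holds if and only if P is a centered simplex. -/

import Mathlib

open MeasureTheory Module
open scoped RealInnerProductSpace

section PrekopaLeindlerAndPyramids

open scoped ENNReal Pointwise

/-- One-dimensional Brunn–Minkowski inequality for compact sets. -/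
theorem volume_add_le_of_isCompact {A B C : Set ℝ} (hA : IsCompact A) (hB : IsCompact B)
    (hAn : A.Nonempty) (hBn : B.Nonempty) (h : ∀ a ∈ A, ∀ b ∈ B, a + b ∈ C) :
    volume A + volume B ≤ volume C := by
  obtain ⟨a, ha, hmax⟩ := hA.exists_isGreatest hAn
  obtain ⟨b, hb, hmin⟩ := hB.exists_isLeast hBn
  have h1 : volume A = volume ((fun x => x + b) '' A) := by
    rw [Set.image_add_right, measure_preimage_add_right]
  have h2 : volume B = volume ((fun x => a + x) '' B) := by
    rw [Set.image_add_left, measure_preimage_add]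
  have hm : MeasurableSet ((fun x => a + x) '' B) :=
    (hB.image (by fun_prop)).measurableSet
  have hd : AEDisjoint volume ((fun x => x + b) '' A) ((fun x => a + x) '' B) := by
    refine measure_mono_null (t := {a + b}) ?_ (by simp)
    rintro _ ⟨⟨x, hx, rfl⟩, ⟨y, hy, hxy⟩⟩
    have := hmax hx
    have := hmin hy
    simp only at hxy
    simp only [Set.mem_singleton_iff]
    linarith
  rw [h1, h2, ← measure_union₀ hm.nullMeasurableSet hd]
  refine measure_mono ?_
  rintro _ (⟨x, hx, rfl⟩ | ⟨x, hx, rfl⟩)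
  · exact h _ hx _ hb
  · exact h _ ha _ hx

/-- One-dimensional Brunn–Minkowski inequality for measurable sets. -/
theorem volume_add_le {A B C : Set ℝ} (hA : MeasurableSet A) (hB : MeasurableSet B)
    (hAn : A.Nonempty) (hBn : B.Nonempty) (h : ∀ a ∈ A, ∀ b ∈ B, a + b ∈ C) :
    volume A + volume B ≤ volume C := by
  have key : ∀ K ⊆ A, IsCompact K → ∀ L ⊆ B, IsCompact L → volume K + volume L ≤ volume C := by
    intro K hKA hK L hLB hL
    obtain ⟨a, ha⟩ := hAn
    obtain ⟨b, hb⟩ := hBn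
    calc volume K + volume L ≤ volume (insert a K) + volume (insert b L) := by
          gcongr <;> exact Set.subset_insert _ _
      _ ≤ volume C := by
          refine volume_add_le_of_isCompact (hK.insert a) (hL.insert b)
            (Set.insert_nonempty _ _) (Set.insert_nonempty _ _) ?_
          intro x hx y hy
          exact h _ (Set.insert_subset ha hKA hx) _ (Set.insert_subset hb hLB hy)
  rw [hA.measure_eq_iSup_isCompact, hB.measure_eq_iSup_isCompact]
  simp only [ENNReal.iSup_add, ENNReal.add_iSup, iSup_le_iff]
  intro L K
  by_cases hK : K ⊆ A <;> by_cases hL : L ⊆ B <;>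
  by_cases hKc : IsCompact K <;> by_cases hLc : IsCompact L <;>
    simp only [hK, hL, hKc, hLc, iSup_true, iSup_false, bot_eq_zero, add_zero, zero_add, zero_le]
  · exact key K hK hKc L hL hLc
  all_goals
    first
      | simpa using key K hK hKc ∅ (by simp) (by simp)
      | simpa using key ∅ (by simp) (by simp) L hL hLc

/-- Weighted arithmetic-geometric mean inequality in `ℝ≥0∞`. -/
theorem ENNReal.rpow_mul_rpow_le_add {p q : ℝ} (hp : 0 < p) (hq : 0 < q) (hpq : p + q = 1)
    (a b : ℝ≥0∞) : a ^ p * b ^ q ≤ ENNReal.ofReal p * a + ENNReal.ofReal q * b := by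
  have hp' : ENNReal.ofReal p ≠ 0 := by simpa using hp
  have hq' : ENNReal.ofReal q ≠ 0 := by simpa using hq
  by_cases ha : a = ⊤
  · simp [ha, ENNReal.mul_top hp']
  by_cases hb : b = ⊤
  · simp [hb, ENNReal.mul_top hq']
  lift a to NNReal using ha
  lift b to NNReal using hb
  lift p to NNReal using hp.le
  lift q to NNReal using hq.le
  rw [← ENNReal.coe_rpow_of_nonneg _ hp.le, ← ENNReal.coe_rpow_of_nonneg _ hq.le,
    ENNReal.ofReal_coe_nnreal, ENNReal.ofReal_coe_nnreal]
  exact_mod_cast NNReal.geom_mean_le_arith_mean2_weighted p q a b (by exact_mod_cast hpq)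

/-- Layer-cake formula for functions bounded by `1`. -/
theorem lintegral_eq_lintegral_meas_ofReal_lt {f : ℝ → ℝ≥0∞} (hf : Measurable f)
    (h1 : ∀ x, f x ≤ 1) :
    ∫⁻ x, f x = ∫⁻ t in Set.Ioi (0 : ℝ), volume {x | ENNReal.ofReal t < f x} := by
  have hfin : ∀ x, f x ≠ ⊤ := fun x => ((h1 x).trans_lt ENNReal.one_lt_top).ne
  have := lintegral_eq_lintegral_meas_lt (f := fun x => (f x).toReal) volume
    (Filter.Eventually.of_forall fun x => ENNReal.toReal_nonneg) hf.ennreal_toReal.aemeasurable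
  simp only [ENNReal.ofReal_toReal (hfin _)] at this
  rw [this]
  refine setLIntegral_congr_fun measurableSet_Ioi fun t ht => ?_
  congr 1
  ext x
  exact (ENNReal.ofReal_lt_iff_lt_toReal (le_of_lt ht) (hfin x)).symm

theorem prekopaLeindler_real_of_iSup_eq_one {p q : ℝ} (hp : 0 < p) (hq : 0 < q) (hpq : p + q = 1)
    {f g h : ℝ → ℝ≥0∞} (hf : Measurable f) (hg : Measurable g) (hh : Measurable h)
    (hf1 : ⨆ x, f x = 1) (hg1 : ⨆ x, g x = 1)
    (H : ∀ x y, f x ^ p * g y ^ q ≤ h (p * x + q * y)) :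
    ENNReal.ofReal p * (∫⁻ x, f x) + ENNReal.ofReal q * (∫⁻ x, g x) ≤ ∫⁻ x, h x := by
  have hfle : ∀ x, f x ≤ 1 := fun x => hf1 ▸ le_iSup f x
  have hgle : ∀ x, g x ≤ 1 := fun x => hg1 ▸ le_iSup g x
  have hmf : Measurable fun t : ℝ => volume {x | ENNReal.ofReal t < f x} :=
    Antitone.measurable fun s t hst => measure_mono fun x hx =>
      (ENNReal.ofReal_le_ofReal hst).trans_lt hx
  refine le_trans ?_ (lintegral_mono (fun x => min_le_left (h x) 1))
  rw [lintegral_eq_lintegral_meas_ofReal_lt hf hfle, lintegral_eq_lintegral_meas_ofReal_lt hg hgle,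
    lintegral_eq_lintegral_meas_ofReal_lt (hh.min measurable_const) (fun x => min_le_right _ _),
    ← lintegral_const_mul' _ _ ENNReal.ofReal_ne_top,
    ← lintegral_const_mul' _ _ ENNReal.ofReal_ne_top,
    ← lintegral_add_left (hmf.const_mul _)]
  refine lintegral_mono fun t => ?_
  by_cases ht : ENNReal.ofReal t < 1
  · have e1 : ∀ (r : ℝ), 0 < r → ∀ S : Set ℝ, ENNReal.ofReal r * volume S = volume (r • S) := by
      intro r hr S
      rw [Measure.addHaar_smul]
      simp [abs_of_pos hr]
    simp only
    rw [e1 p hp, e1 q hq]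
    have hfn : {x | ENNReal.ofReal t < f x}.Nonempty := by
      rw [← hf1] at ht
      exact lt_iSup_iff.1 ht
    have hgn : {x | ENNReal.ofReal t < g x}.Nonempty := by
      rw [← hg1] at ht
      exact lt_iSup_iff.1 ht
    refine volume_add_le ((measurableSet_lt measurable_const hf).const_smul_of_ne_zero hp.ne')
      ((measurableSet_lt measurable_const hg).const_smul_of_ne_zero hq.ne')
      hfn.smul_set hgn.smul_set ?_
    rintro _ ⟨x, hx, rfl⟩ _ ⟨y, hy, rfl⟩
    simp only [Set.mem_ofPred_eq, smul_eq_mul] at hx hy ⊢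
    refine lt_min (lt_of_lt_of_le ?_ (H x y)) ht
    calc ENNReal.ofReal t = ENNReal.ofReal t ^ p * ENNReal.ofReal t ^ q := by
          rw [← ENNReal.rpow_add_of_nonneg _ _ hp.le hq.le, hpq, ENNReal.rpow_one]
      _ < f x ^ p * g y ^ q :=
          ENNReal.mul_lt_mul (ENNReal.rpow_lt_rpow hx hp) (ENNReal.rpow_lt_rpow hy hq)
  · have h1 : {x | ENNReal.ofReal t < f x} = ∅ := by
      ext x; simpa using (hfle x).trans (not_lt.1 ht)
    have h2 : {x | ENNReal.ofReal t < g x} = ∅ := by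
      ext x; simpa using (hgle x).trans (not_lt.1 ht)
    simp [h1, h2]

/-- The Prékopa–Leindler inequality for a measure, with weights `p` and `q`. -/
def PrekopaLeindler {X : Type*} [AddCommGroup X] [Module ℝ X] [MeasurableSpace X]
    (μ : Measure X) (p q : ℝ) : Prop :=
  ∀ f g h : X → ℝ≥0∞, Measurable f → Measurable g → Measurable h →
    (∀ x y, f x ^ p * g y ^ q ≤ h (p • x + q • y)) →
    (∫⁻ x, f x ∂μ) ^ p * (∫⁻ x, g x ∂μ) ^ q ≤ ∫⁻ x, h x ∂μ

theorem prekopaLeindler_real_of_bounded {p q : ℝ} (hp : 0 < p) (hq : 0 < q) (hpq : p + q = 1)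
    {f g h : ℝ → ℝ≥0∞} (hf : Measurable f) (hg : Measurable g) (hh : Measurable h)
    (hf1 : ⨆ x, f x ≠ ⊤) (hg1 : ⨆ x, g x ≠ ⊤)
    (H : ∀ x y, f x ^ p * g y ^ q ≤ h (p * x + q * y)) :
    (∫⁻ x, f x) ^ p * (∫⁻ x, g x) ^ q ≤ ∫⁻ x, h x := by
  set M := ⨆ x, f x with hM
  set N := ⨆ x, g x with hN
  by_cases hM0 : M = 0
  · have : ∀ x, f x = 0 := by simpa [hM] using hM0
    simp [this, hp]
  by_cases hN0 : N = 0
  · have : ∀ x, g x = 0 := by simpa [hN] using hN0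
    simp [this, hq]
  have hc0 : M ^ p * N ^ q ≠ 0 := by
    simp [hM0, hN0, hf1, hg1, ENNReal.rpow_eq_zero_iff]
  have hct : M ^ p * N ^ q ≠ ⊤ :=
    ENNReal.mul_ne_top (ENNReal.rpow_ne_top_of_nonneg hp.le hf1)
      (ENNReal.rpow_ne_top_of_nonneg hq.le hg1)
  have key := prekopaLeindler_real_of_iSup_eq_one hp hq hpq (f := fun x => M⁻¹ * f x)
    (g := fun x => N⁻¹ * g x) (h := fun x => (M ^ p * N ^ q)⁻¹ * h x)
    (hf.const_mul _) (hg.const_mul _) (hh.const_mul _)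
    (by rw [← ENNReal.mul_iSup, ENNReal.inv_mul_cancel hM0 hf1])
    (by rw [← ENNReal.mul_iSup, ENNReal.inv_mul_cancel hN0 hg1]) (by
      intro x y
      rw [ENNReal.mul_rpow_of_nonneg _ _ hp.le, ENNReal.mul_rpow_of_nonneg _ _ hq.le,
        ENNReal.mul_inv (Or.inr (ENNReal.rpow_ne_top_of_nonneg hq.le hg1))
          (Or.inl (ENNReal.rpow_ne_top_of_nonneg hp.le hf1)),
        ENNReal.inv_rpow, ENNReal.inv_rpow, mul_mul_mul_comm]
      gcongr
      exact H x y)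
  have key2 := (ENNReal.rpow_mul_rpow_le_add hp hq hpq _ _).trans key
  rw [lintegral_const_mul _ hf, lintegral_const_mul _ hg, lintegral_const_mul _ hh,
    ENNReal.mul_rpow_of_nonneg _ _ hp.le, ENNReal.mul_rpow_of_nonneg _ _ hq.le,
    mul_mul_mul_comm, ENNReal.inv_rpow, ENNReal.inv_rpow,
    ← ENNReal.mul_inv (Or.inr (ENNReal.rpow_ne_top_of_nonneg hq.le hg1))
      (Or.inl (ENNReal.rpow_ne_top_of_nonneg hp.le hf1))] at key2
  rwa [ENNReal.mul_le_mul_iff_right (ENNReal.inv_ne_zero.2 hct) (ENNReal.inv_ne_top.2 hc0)] at key2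

theorem iSup_lintegral_min_natCast {f : ℝ → ℝ≥0∞} (hf : Measurable f) :
    ⨆ n : ℕ, ∫⁻ x, min (f x) n = ∫⁻ x, f x := by
  rw [← lintegral_iSup (fun n => hf.min measurable_const)
    (fun m n hmn x => min_le_min_left _ (by exact_mod_cast hmn))]
  congr 1
  ext x
  have := inf_iSup_eq (f x) (fun n : ℕ => (n : ℝ≥0∞))
  rw [ENNReal.iSup_natCast] at this
  simpa using this.symm

theorem prekopaLeindler_real {p q : ℝ} (hp : 0 < p) (hq : 0 < q) (hpq : p + q = 1) :
    PrekopaLeindler (volume : Measure ℝ) p q := by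
  intro f g h hf hg hh H
  have key : ∀ n : ℕ, (∫⁻ x, min (f x) n) ^ p * (∫⁻ x, min (g x) n) ^ q ≤ ∫⁻ x, h x := by
    intro n
    refine prekopaLeindler_real_of_bounded hp hq hpq (hf.min measurable_const)
      (hg.min measurable_const) hh
      (ne_top_of_le_ne_top (ENNReal.natCast_ne_top n) (iSup_le fun x => min_le_right _ _))
      (ne_top_of_le_ne_top (ENNReal.natCast_ne_top n) (iSup_le fun x => min_le_right _ _)) ?_
    intro x y
    refine le_trans ?_ (H x y)
    gcongr <;> exact min_le_left _ _
  have lim : ∀ u : ℝ → ℝ≥0∞, Measurable u → Filter.Tendsto (fun n : ℕ => ∫⁻ x, min (u x) n)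
      Filter.atTop (nhds (∫⁻ x, u x)) := by
    intro u hu
    rw [← iSup_lintegral_min_natCast hu]
    exact tendsto_atTop_iSup fun m n hmn => lintegral_mono fun x =>
      min_le_min_left _ (by exact_mod_cast hmn)
  by_cases h1 : ∫⁻ x, f x = 0
  · simp [h1, hp]
  by_cases h2 : ∫⁻ x, g x = 0
  · simp [h2, hq]
  refine le_of_tendsto' (ENNReal.Tendsto.mul ((ENNReal.continuous_rpow_const.tendsto _).comp
    (lim f hf)) (Or.inl ?_) ((ENNReal.continuous_rpow_const.tendsto _).comp (lim g hg))
    (Or.inl ?_)) key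
  · simp [ENNReal.rpow_eq_zero_iff, h1, hp.not_gt]
  · simp [ENNReal.rpow_eq_zero_iff, h2, hq.not_gt]

theorem PrekopaLeindler.prod {X Y : Type*} [AddCommGroup X] [Module ℝ X] [MeasurableSpace X]
    [AddCommGroup Y] [Module ℝ Y] [MeasurableSpace Y] {μ : Measure X} {ν : Measure Y}
    [SFinite μ] [SFinite ν] {p q : ℝ}
    (hμ : PrekopaLeindler μ p q) (hν : PrekopaLeindler ν p q) :
    PrekopaLeindler (μ.prod ν) p q := by
  intro f g h hf hg hh H
  rw [lintegral_prod _ hf.aemeasurable, lintegral_prod _ hg.aemeasurable,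
    lintegral_prod _ hh.aemeasurable]
  refine hμ _ _ _ hf.lintegral_prod_right' hg.lintegral_prod_right' hh.lintegral_prod_right' ?_
  intro x₁ x₂
  exact hν _ _ _ (hf.comp measurable_prodMk_left) (hg.comp measurable_prodMk_left)
    (hh.comp measurable_prodMk_left) fun y₁ y₂ => H (x₁, y₁) (x₂, y₂)

theorem prekopaLeindler_pi {p q : ℝ} (hp : 0 < p) (hq : 0 < q) (hpq : p + q = 1) (d : ℕ) :
    PrekopaLeindler (volume : Measure (Fin d → ℝ)) p q := by
  induction d with
  | zero =>
    intro f g h _ _ _ H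
    simp only [volume_pi, Measure.pi_of_empty _ (0 : Fin 0 → ℝ), lintegral_dirac]
    simpa using H 0 0
  | succ d ih =>
    intro f g h hf hg hh H
    have hmp := (volume_preserving_piFinSuccAbove (fun _ : Fin (d + 1) => ℝ) 0).symm
    rw [← hmp.lintegral_comp hf, ← hmp.lintegral_comp hg, ← hmp.lintegral_comp hh]
    refine (prekopaLeindler_real hp hq hpq).prod ih _ _ _ (hf.comp hmp.measurable)
      (hg.comp hmp.measurable) (hh.comp hmp.measurable) ?_
    intro x y
    convert H _ _ using 2
    ext i
    refine Fin.cases ?_ (fun j => ?_) i <;> simp [MeasurableEquiv.piFinSuccAbove]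

/-- Multiplicative Brunn–Minkowski inequality, in quasi-concave form. -/
theorem le_volume_of_combo {d : ℕ} {p q : ℝ} (hp : 0 < p) (hq : 0 < q) (hpq : p + q = 1)
    {A B C : Set (Fin d → ℝ)} (hA : MeasurableSet A) (hB : MeasurableSet B)
    (hC : MeasurableSet C) (H : ∀ x ∈ A, ∀ y ∈ B, p • x + q • y ∈ C) {c : ℝ≥0∞}
    (hcA : c ≤ volume A) (hcB : c ≤ volume B) : c ≤ volume C := by
  have := prekopaLeindler_pi hp hq hpq d (A.indicator 1) (B.indicator 1) (C.indicator 1)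
    (measurable_one.indicator hA) (measurable_one.indicator hB) (measurable_one.indicator hC) (by
      intro x y
      by_cases hx : x ∈ A <;> by_cases hy : y ∈ B <;> simp [hx, hy, hp, hq, H])
  rw [lintegral_indicator_one hA, lintegral_indicator_one hB, lintegral_indicator_one hC] at this
  calc c = c ^ p * c ^ q := by
        rw [← ENNReal.rpow_add_of_nonneg _ _ hp.le hq.le, hpq, ENNReal.rpow_one]
    _ ≤ volume A ^ p * volume B ^ q := by gcongr
    _ ≤ volume C := this

/-! ### Comparison of a one-dimensional profile with a power profile -/

theorem intervalIntegral_one_sub_div_pow {H : ℝ} (hH : 0 < H) (d : ℕ) :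
    ∫ u in (0 : ℝ)..H, (1 - u / H) ^ d = H / (d + 1) := by
  have h : ∀ u ∈ Set.uIcc 0 H, HasDerivAt (fun u => -(H / (d + 1)) * (1 - u / H) ^ (d + 1))
      ((1 - u / H) ^ d) u := by
    intro u _
    have h1 : HasDerivAt (fun u : ℝ => 1 - u / H) (-(1 / H)) u :=
      ((hasDerivAt_id u).div_const H).const_sub 1
    convert! (h1.pow (d + 1)).const_mul (-(H / (d + 1 : ℝ))) using 1
    push_cast
    field_simp
  rw [intervalIntegral.integral_eq_sub_of_hasDerivAt h
    ((by fun_prop : Continuous fun u : ℝ => (1 - u / H) ^ d).intervalIntegrable _ _)]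
  simp [hH.ne']

/-- The profile `u ↦ c (1 - u / H) ^ d` on `[0, H]` of a pyramid of height `H`. -/
noncomputable def coneProfile (c H : ℝ) (d : ℕ) : ℝ → ℝ :=
  (Set.Icc 0 H).indicator fun u => c * (1 - u / H) ^ d

theorem integrable_mul_coneProfile {φ : ℝ → ℝ} (hφ : Continuous φ) (c H : ℝ) (d : ℕ) :
    Integrable fun u => φ u * coneProfile c H d u := by
  have : (fun u => φ u * coneProfile c H d u) =
      (Set.Icc 0 H).indicator fun u => φ u * (c * (1 - u / H) ^ d) := by
    ext u
    by_cases hu : u ∈ Set.Icc 0 H <;> simp [coneProfile, hu]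
  rw [this, integrable_indicator_iff measurableSet_Icc]
  exact (by fun_prop : Continuous fun u => φ u * (c * (1 - u / H) ^ d)).continuousOn.integrableOn_Icc

theorem integral_coneProfile (c : ℝ) {H : ℝ} (hH : 0 < H) (d : ℕ) :
    ∫ u, coneProfile c H d u = c * H / (d + 1) := by
  rw [coneProfile, integral_indicator measurableSet_Icc, integral_Icc_eq_integral_Ioc,
    ← intervalIntegral.integral_of_le hH.le, intervalIntegral.integral_const_mul,
    intervalIntegral_one_sub_div_pow hH]
  ring

theorem integral_mul_coneProfile (c : ℝ) {H : ℝ} (hH : 0 < H) (d : ℕ) :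
    ∫ u, u * coneProfile c H d u = c * H ^ 2 / ((d + 1) * (d + 2)) := by
  have h : ∀ u, u * coneProfile c H d u = H * coneProfile c H d u - H * coneProfile c H (d + 1) u := by
    intro u
    by_cases hu : u ∈ Set.Icc 0 H
    · have h1 : u = H - H * (1 - u / H) := by field_simp; ring
      simp only [coneProfile, hu, Set.indicator_of_mem, pow_succ]
      nth_rewrite 1 [h1]
      ring
    · simp [coneProfile, hu]
  have hi := fun d => integrable_mul_coneProfile (φ := fun _ => H) continuous_const c H d
  simp only [h]
  rw [integral_sub (hi _) (hi _), integral_const_mul, integral_const_mul,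
    integral_coneProfile c hH, integral_coneProfile c hH]
  push_cast
  field_simp
  ring

theorem integral_mul_lt_of_coneProfile {d : ℕ} {f : ℝ → ℝ} {U H c : ℝ} (hUH : U < H) (hU : 0 ≤ U)
    (hc : 0 < c) (hf0 : f 0 = c) (hfs : ∀ u, u ∉ Set.Icc 0 U → f u = 0)
    (hconc : ∀ u₁, 0 ≤ u₁ → u₁ < H → c * (1 - u₁ / H) ^ d ≤ f u₁ →
      ∀ u, 0 ≤ u → u ≤ u₁ → c * (1 - u / H) ^ d ≤ f u)
    (hi : Integrable f) (hi' : Integrable fun u => u * f u)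
    (hmean : ∫ u, f u = c * H / (d + 1)) :
    ∫ u, u * f u < c * H ^ 2 / ((d + 1) * (d + 2)) := by
  have hH : 0 < H := hU.trans_lt hUH
  set g := coneProfile c H d with hg
  have hgi : Integrable g := by
    simpa using integrable_mul_coneProfile (φ := fun _ => 1) continuous_const c H d
  have hgi' : Integrable fun u => u * g u := integrable_mul_coneProfile continuous_id c H d
  have gin : ∀ u, 0 ≤ u → u ≤ H → g u = c * (1 - u / H) ^ d := fun u h0 h1 => by
    simp [hg, coneProfile, h0, h1]
  have gout : ∀ u, u < 0 → g u = 0 := fun u h0 => by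
    simp [hg, coneProfile, h0.not_ge]
  have gnn : ∀ u, 0 ≤ g u := by
    intro u
    refine Set.indicator_nonneg (fun u hu => ?_) u
    have : u / H ≤ 1 := (div_le_one hH).2 hu.2
    have : 0 ≤ 1 - u / H := by linarith
    positivity
  set S := {u | 0 ≤ u ∧ u ≤ U ∧ g u ≤ f u} with hS
  have h0S : (0 : ℝ) ∈ S := ⟨le_rfl, hU, by rw [gin 0 le_rfl hH.le, hf0]; simp⟩
  have hbdd : BddAbove S := ⟨U, fun u hu => hu.2.1⟩
  set u₀ := sSup S
  have hu0U : u₀ ≤ U := csSup_le ⟨0, h0S⟩ fun u hu => hu.2.1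
  have hbelow : ∀ u, 0 ≤ u → u < u₀ → g u ≤ f u := by
    intro u hu hlt
    obtain ⟨v, hv, huv⟩ := exists_lt_of_lt_csSup ⟨0, h0S⟩ hlt
    have hvH := hv.2.1.trans_lt hUH
    have h3 := hv.2.2
    rw [gin v hv.1 hvH.le] at h3
    rw [gin u hu (huv.trans hvH).le]
    exact hconc v hv.1 hvH h3 u hu huv.le
  have hu00 : 0 ≤ u₀ := le_csSup hbdd h0S
  have habove : ∀ u, u₀ < u → f u ≤ g u := by
    intro u hu
    by_cases huU : u ≤ U
    · by_contra! hlt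
      exact hu.not_ge (le_csSup hbdd ⟨hu00.trans hu.le, huU, hlt.le⟩)
    · rw [hfs u fun h => huU h.2]
      exact gnn u
  set D : ℝ → ℝ := fun u => (u - u₀) * (g u - f u) with hD
  have hDi : Integrable D := by
    have : D = fun u => u * g u - u * f u - (u₀ * g u - u₀ * f u) := by ext u; simp only [hD]; ring
    rw [this]
    exact (hgi'.sub hi').sub ((hgi.const_mul _).sub (hi.const_mul _))
  have hDnn : ∀ u, 0 ≤ D u := by
    intro u
    rcases lt_trichotomy u u₀ with h | h | h
    · refine mul_nonneg_of_nonpos_of_nonpos (by linarith) ?_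
      by_cases hu : 0 ≤ u
      · linarith [hbelow u hu h]
      · rw [gout u (not_le.1 hu), hfs u fun h => hu h.1]; simp
    · simp [hD, h]
    · exact mul_nonneg (by linarith) (by linarith [habove u h])
  have hDpos : 0 < ∫ u, D u := by
    rw [integral_pos_iff_support_of_nonneg hDnn hDi]
    refine lt_of_lt_of_le ?_ (measure_mono (s := Set.Ioo U H) ?_)
    · simpa using hUH
    · intro u hu
      refine (mul_pos (by linarith [hu.1]) ?_).ne'
      rw [hfs u fun h => hu.1.not_ge h.2, gin u (hU.trans hu.1.le) hu.2.le]
      have : u / H < 1 := (div_lt_one hH).2 hu.2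
      have : 0 < 1 - u / H := by linarith
      simp only [sub_zero]
      positivity
  have hDint : ∫ u, D u = ∫ u, u * g u - u * f u - (u₀ * g u - u₀ * f u) := by
    congr 1; ext u; simp only [hD]; ring
  have e1 : Integrable fun u => u * g u - u * f u := hgi'.sub hi'
  have e2 : Integrable fun u => u₀ * g u - u₀ * f u := (hgi.const_mul _).sub (hi.const_mul _)
  rw [hDint, integral_sub e1 e2, integral_sub hgi' hi',
    integral_sub (hgi.const_mul _) (hi.const_mul _), integral_const_mul, integral_const_mul, hmean,
    integral_coneProfile c hH, integral_mul_coneProfile c hH] at hDpos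
  linarith

/-! ### Sections of sets in `ℝ × (Fin d → ℝ)` -/

/-- The volume of the section of `S` at height `u`. -/
noncomputable def sectionVolume {d : ℕ} (S : Set (ℝ × (Fin d → ℝ))) (u : ℝ) : ℝ :=
  volume.real (Prod.mk u ⁻¹' S)

theorem integrable_mul_sectionVolume {d : ℕ} {S : Set (ℝ × (Fin d → ℝ))} (hS : IsCompact S)
    {φ : ℝ → ℝ} (hφ : Continuous φ) :
    Integrable (fun u => φ u * sectionVolume S u) ∧
      ∫ x in S, φ x.1 = ∫ u, φ u * sectionVolume S u := by
  have hm := hS.measurableSet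
  have hi : Integrable (S.indicator fun x => φ x.1) :=
    (integrable_indicator_iff hm).2
      ((hφ.comp continuous_fst).continuousOn.integrableOn_compact hS)
  have h : ∀ u, ∫ w, S.indicator (fun x => φ x.1) (u, w) = φ u * sectionVolume S u := by
    intro u
    have : (fun w => S.indicator (fun x => φ x.1) (u, w)) =
        (Prod.mk u ⁻¹' S).indicator fun _ => φ u := by
      ext w; by_cases hw : (u, w) ∈ S <;> simp [hw]
    rw [this, integral_indicator (measurable_prodMk_left hm), setIntegral_const, smul_eq_mul,
      mul_comm, sectionVolume]
  rw [Measure.volume_eq_prod] at hi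
  constructor
  · simpa only [h] using hi.integral_prod_left
  · rw [← integral_indicator hm, Measure.volume_eq_prod, integral_prod _ hi]
    simp only [h]

theorem integral_sectionVolume {d : ℕ} {S : Set (ℝ × (Fin d → ℝ))} (hS : IsCompact S) :
    Integrable (sectionVolume S) ∧ ∫ u, sectionVolume S u = volume.real S := by
  have := integrable_mul_sectionVolume hS (φ := fun _ => 1) continuous_const
  simpa [eq_comm] using this

theorem sectionVolume_pyramid {d : ℕ} {B : Set (Fin d → ℝ)} (hB : Convex ℝ B) (hBn : B.Nonempty)
    {h : ℝ} (hh : 0 < h) (w : Fin d → ℝ) :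
    sectionVolume (convexHull ℝ (insert (h, w) ({0} ×ˢ B))) = coneProfile (volume.real B) h d := by
  have hne : (({0} : Set ℝ) ×ˢ B).Nonempty := (Set.singleton_nonempty _).prod hBn
  have hconv : Convex ℝ (({0} : Set ℝ) ×ˢ B) := (convex_singleton _).prod hB
  ext u
  rw [convexHull_insert hne, hconv.convexHull_eq, convexJoin_singleton_left]
  by_cases hu : u ∈ Set.Icc 0 h
  · have : Prod.mk u ⁻¹' (⋃ x ∈ ({0} : Set ℝ) ×ˢ B, segment ℝ (h, w) x) =
        (fun x => (u / h) • w + x) '' ((1 - u / h) • B) := by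
      ext y
      simp only [Set.mem_preimage, Set.mem_iUnion, Set.mem_image, Set.mem_smul_set]
      constructor
      · rintro ⟨⟨t, b⟩, ⟨rfl, hb⟩, ⟨p, q, hp, hq, hpq, heq⟩⟩
        simp only [Prod.smul_mk, Prod.mk_add_mk, smul_eq_mul, mul_zero, add_zero,
          Prod.mk.injEq] at heq
        refine ⟨_, ⟨b, hb, rfl⟩, ?_⟩
        rw [← heq.1, mul_div_assoc, div_self hh.ne', mul_one, ← heq.2, ← hpq]
        simp
      · rintro ⟨_, ⟨b, hb, rfl⟩, rfl⟩
        refine ⟨(0, b), ⟨rfl, hb⟩, ⟨u / h, 1 - u / h, div_nonneg hu.1 hh.le, ?_, by ring, ?_⟩⟩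
        · have : u / h ≤ 1 := (div_le_one hh).2 hu.2
          linarith
        · simp [hh.ne']
    have h1 : 0 ≤ 1 - u / h := by
      have : u / h ≤ 1 := (div_le_one hh).2 hu.2
      linarith
    rw [sectionVolume, this, coneProfile, Set.indicator_of_mem hu, Set.image_add_left, measureReal_def,
      measure_preimage_add, Measure.addHaar_smul, ENNReal.toReal_mul, measureReal_def, mul_comm]
    simp [abs_of_nonneg, h1]
  · have : Prod.mk u ⁻¹' (⋃ x ∈ ({0} : Set ℝ) ×ˢ B, segment ℝ (h, w) x) = ∅ := by
      ext y
      simp only [Set.mem_preimage, Set.mem_iUnion, Set.mem_empty_iff_false, iff_false]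
      rintro ⟨⟨t, b⟩, ⟨rfl, hb⟩, ⟨p, q, hp, hq, hpq, heq⟩⟩
      simp only [Prod.smul_mk, Prod.mk_add_mk, smul_eq_mul, mul_zero, add_zero,
        Prod.mk.injEq] at heq
      exact hu ⟨by rw [← heq.1]; positivity, by rw [← heq.1]; nlinarith⟩
    rw [sectionVolume, this, coneProfile, Set.indicator_of_notMem hu]
    simp

theorem isCompact_pyramid {d : ℕ} {B : Set (Fin d → ℝ)} (hB : Convex ℝ B) (hBc : IsCompact B)
    (z : ℝ × (Fin d → ℝ)) : IsCompact (convexHull ℝ (insert z (({0} : Set ℝ) ×ˢ B))) := by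
  rcases B.eq_empty_or_nonempty with rfl | hBn
  · simp
  have : convexHull ℝ (insert z (({0} : Set ℝ) ×ˢ B)) =
      (fun x : ℝ × (Fin d → ℝ) => (1 - x.1) • z + x.1 • ((0 : ℝ), x.2)) '' (Set.Icc 0 1 ×ˢ B) := by
    rw [convexHull_insert ((Set.singleton_nonempty _).prod hBn),
      ((convex_singleton _).prod hB).convexHull_eq, convexJoin_singleton_left]
    ext y
    simp only [segment_eq_image, Set.mem_iUnion, Set.mem_image, Set.mem_prod,
      Set.mem_singleton_iff, Prod.exists]
    constructor
    · rintro ⟨_, b, ⟨rfl, hb⟩, t, ht, rfl⟩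
      exact ⟨t, b, ⟨ht, hb⟩, rfl⟩
    · rintro ⟨t, b, ⟨ht, hb⟩, rfl⟩
      exact ⟨0, b, ⟨rfl, hb⟩, t, ht, rfl⟩
  rw [this]
  exact (isCompact_Icc.prod hBc).image (by fun_prop)

theorem volume_pyramid {d : ℕ} {B : Set (Fin d → ℝ)} (hB : Convex ℝ B) (hBc : IsCompact B)
    (hBn : B.Nonempty) {z : ℝ × (Fin d → ℝ)} (hz : 0 < z.1) :
    volume.real (convexHull ℝ (insert z (({0} : Set ℝ) ×ˢ B))) =
      volume.real B * z.1 / (d + 1) := by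
  rw [← (integral_sectionVolume (isCompact_pyramid hB hBc z)).2, sectionVolume_pyramid hB hBn hz,
    integral_coneProfile _ hz]

theorem integral_fst_pyramid {d : ℕ} {B : Set (Fin d → ℝ)} (hB : Convex ℝ B) (hBc : IsCompact B)
    (hBn : B.Nonempty) {z : ℝ × (Fin d → ℝ)} (hz : 0 < z.1) :
    ∫ x in convexHull ℝ (insert z (({0} : Set ℝ) ×ˢ B)), x.1 =
      volume.real B * z.1 ^ 2 / ((d + 1) * (d + 2)) := by
  refine (integrable_mul_sectionVolume (isCompact_pyramid hB hBc z) continuous_id).2.trans ?_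
  rw [sectionVolume_pyramid hB hBn hz]
  exact integral_mul_coneProfile _ hz d

theorem coneProfile_le_sectionVolume {d : ℕ} {K : Set (ℝ × (Fin d → ℝ))} (hKc : IsCompact K)
    (hK : Convex ℝ K) {c H : ℝ} (hH : 0 < H) (h0 : c ≤ sectionVolume K 0) {u₁ : ℝ}
    (hu₁ : u₁ < H) (h1 : c * (1 - u₁ / H) ^ d ≤ sectionVolume K u₁)
    {u : ℝ} (hu0 : 0 ≤ u) (huu : u ≤ u₁) : c * (1 - u / H) ^ d ≤ sectionVolume K u := by
  rcases hu0.eq_or_lt with rfl | hu0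
  · simpa using h0
  rcases huu.eq_or_lt with rfl | huu
  · exact h1
  have hu₁0 : 0 < u₁ := hu0.trans huu
  have hcl : ∀ v, IsCompact (Prod.mk v ⁻¹' K) := fun v =>
    (hKc.image continuous_snd).of_isClosed_subset
      (hKc.isClosed.preimage (by fun_prop)) fun w hw => ⟨_, hw, rfl⟩
  have hr : 0 < 1 - u₁ / H := by
    have : u₁ / H < 1 := (div_lt_one hH).2 hu₁
    linarith
  have hs : 0 < 1 - u / H := by
    have : u / H < 1 := (div_lt_one hH).2 (huu.trans hu₁)
    linarith
  set r := 1 - u₁ / H with hr_def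
  set s := 1 - u / H with hs_def
  set l := u / u₁ with hl
  have hl0 : 0 < l := by positivity
  have hl1 : 0 < 1 - l := by
    have : u / u₁ < 1 := (div_lt_one hu₁0).2 huu
    linarith
  have hlu : l * u₁ = u := by rw [hl]; field_simp
  have hsl : s = (1 - l) + l * r := by
    rw [hs_def, hr_def, ← hlu]; ring
  have hvol : ∀ t : ℝ, 0 < t → ∀ v, volume (t⁻¹ • (Prod.mk v ⁻¹' K)) =
      ENNReal.ofReal ((t ^ d)⁻¹ * sectionVolume K v) := by
    intro t ht v
    rw [Measure.addHaar_smul, sectionVolume, measureReal_def, ENNReal.ofReal_mul (by positivity),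
      ENNReal.ofReal_toReal (hcl v).measure_lt_top.ne]
    congr 2
    simp [abs_of_pos ht]
  have key := le_volume_of_combo (d := d) (p := (1 - l) / s) (q := l * r / s) (by positivity)
    (by positivity) (by rw [← add_div, ← hsl, div_self hs.ne'])
    (A := Prod.mk 0 ⁻¹' K) (B := r⁻¹ • (Prod.mk u₁ ⁻¹' K)) (C := s⁻¹ • (Prod.mk u ⁻¹' K))
    (hcl 0).measurableSet ((hcl u₁).smul _).measurableSet ((hcl u).smul _).measurableSet (by
      rintro x hx _ ⟨y, hy, rfl⟩
      refine ⟨(1 - l) • x + l • y, ?_, ?_⟩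
      · have := hK hx hy hl1.le hl0.le (by ring)
        simpa [hlu] using this
      · simp only [smul_add, smul_smul]
        congr 2 <;> field_simp)
    (c := ENNReal.ofReal c) (by
      rw [ENNReal.ofReal_le_iff_le_toReal (hcl 0).measure_lt_top.ne]
      exact h0) (by
      rw [hvol r hr]
      refine ENNReal.ofReal_le_ofReal ?_
      rw [inv_mul_eq_div, le_div_iff₀ (by positivity)]
      exact h1)
  rw [hvol s hs, ENNReal.ofReal_le_ofReal_iff (by unfold sectionVolume; positivity),
    inv_mul_eq_div, le_div_iff₀ (by positivity)] at key
  exact key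

/-- A compact convex subset of the same volume fills a convex body. -/
theorem eq_of_volume_le {E : Type*} [NormedAddCommGroup E] [NormedSpace ℝ E] [MeasurableSpace E]
    [BorelSpace E] [FiniteDimensional ℝ E] (μ : Measure E) [μ.IsAddHaarMeasure] {K T : Set E}
    (hKc : IsCompact K) (hK : Convex ℝ K) (hKi : (interior K).Nonempty) (hT : IsCompact T)
    (hTK : T ⊆ K) (h : μ.real K ≤ μ.real T) : K = T := by
  refine (Set.Subset.antisymm hTK ?_).symm
  have h0 : μ (K \ T) = 0 := by
    rw [measure_sdiff hTK hT.measurableSet.nullMeasurableSet hT.measure_lt_top.ne,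
      tsub_eq_zero_iff_le]
    exact (ENNReal.toReal_le_toReal hKc.measure_lt_top.ne hT.measure_lt_top.ne).1 h
  have h1 : interior K \ T = ∅ := by
    refine (isOpen_interior.sdiff hT.isClosed).eq_empty_of_measure_zero (μ := μ) ?_
    exact measure_mono_null (Set.sdiff_subset_sdiff_left interior_subset) h0
  calc K ⊆ closure K := subset_closure
    _ = closure (interior K) := (hK.closure_interior_eq_closure_of_nonempty_interior hKi).symm
    _ ⊆ T := closure_minimal (Set.sdiff_eq_empty.1 h1) hT.isClosed

/-- A convex body on the positive side of a facet `{0} × B`, whose centroid has height `1` and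
whose volume is at most that of a pyramid over `B` of height `d + 2`, is a pyramid over `B`. -/
theorem exists_eq_pyramid {d : ℕ} {K : Set (ℝ × (Fin d → ℝ))} (hKc : IsCompact K)
    (hK : Convex ℝ K) (hKi : (interior K).Nonempty) (hpos : ∀ x ∈ K, 0 ≤ x.1)
    (hc : 0 < volume.real (Prod.mk 0 ⁻¹' K)) (hmean : ∫ x in K, x.1 = volume.real K)
    (hvol : volume.real K ≤ (d + 2) * (volume.real (Prod.mk 0 ⁻¹' K) / (d + 1))) :
    ∃ z ∈ K, 0 < z.1 ∧ K = convexHull ℝ (insert z ({0} ×ˢ (Prod.mk 0 ⁻¹' K))) := by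
  set B := Prod.mk 0 ⁻¹' K with hB
  set c := volume.real B with hcd
  set V := volume.real K with hV
  have hVpos : 0 < V :=
    ENNReal.toReal_pos (Measure.measure_pos_of_nonempty_interior _ hKi).ne' hKc.measure_lt_top.ne
  have hBconv : Convex ℝ B := by
    intro x hx y hy p q hp hq hpq
    have := hK hx hy hp hq hpq
    simpa [hB] using this
  have hBc : IsCompact B := (hKc.image continuous_snd).of_isClosed_subset
      (hKc.isClosed.preimage (by fun_prop)) fun w hw => ⟨_, hw, rfl⟩
  have hBn : B.Nonempty := by
    by_contra h
    rw [Set.not_nonempty_iff_eq_empty] at h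
    simp [hcd, h] at hc
  have hKn : K.Nonempty := hKi.mono interior_subset
  obtain ⟨z, hz, hmax⟩ := hKc.exists_isMaxOn hKn continuous_fst.continuousOn
  set H := (d + 1) * V / c with hH
  have hHpos : 0 < H := by positivity
  have hVH : V = c * H / (d + 1) := by rw [hH]; field_simp
  have hHd : H ≤ d + 2 := by
    rw [hH, div_le_iff₀ hc]
    rw [← mul_div_assoc, le_div_iff₀ (by positivity)] at hvol
    linarith
  have hle : H ≤ z.1 := by
    by_contra! hlt
    obtain ⟨i1, e1⟩ := integral_sectionVolume hKc
    obtain ⟨i2, e2⟩ := integrable_mul_sectionVolume hKc continuous_id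
    have := integral_mul_lt_of_coneProfile (d := d) (f := sectionVolume K) hlt (hpos z hz) hc
      rfl (by
        intro u hu
        have : Prod.mk u ⁻¹' K = ∅ := by
          ext w
          simp only [Set.mem_preimage, Set.mem_empty_iff_false, iff_false]
          exact fun hw => hu ⟨hpos _ hw, hmax hw⟩
        simp [sectionVolume, this]) (by
        intro u₁ _ hu₁ h1 u hu0 huu
        exact coneProfile_le_sectionVolume hKc hK hHpos le_rfl hu₁ h1 hu0 huu) i1 i2
        (by rw [e1]; exact hVH)
    simp only [id] at e2
    rw [← e2, hmean] at this
    have h3 : c * H ^ 2 / ((d + 1) * (d + 2)) = V * (H / (d + 2)) := by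
      rw [hVH]; field_simp
    have h4 : H / (d + 2) ≤ 1 := (div_le_one (by positivity)).2 hHd
    rw [h3] at this
    nlinarith
  have hz0 : 0 < z.1 := hHpos.trans_le hle
  have : (volume : Measure (ℝ × (Fin d → ℝ))).IsAddHaarMeasure := by
    rw [Measure.volume_eq_prod]; infer_instance
  refine ⟨z, hz, hz0, eq_of_volume_le volume hKc hK hKi (isCompact_pyramid hBconv hBc z) ?_ ?_⟩
  · refine convexHull_min (Set.insert_subset hz ?_) hK
    rintro ⟨t, w⟩ ⟨rfl, hw⟩
    exact hw
  · rw [volume_pyramid hBconv hBc hBn hz0, ← hV, hVH]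
    gcongr

/-! ### Facets and pyramids in a Euclidean space -/

section Transfer

variable {E : Type*} [NormedAddCommGroup E] [InnerProductSpace ℝ E] [FiniteDimensional ℝ E]

theorem exists_continuousLinearEquiv_fst_eq_inner {d : ℕ} (hd : finrank ℝ E = d + 1) {a : E}
    (ha : a ≠ 0) : ∃ φ : E ≃L[ℝ] ℝ × (Fin d → ℝ), ∀ x, (φ x).1 = ⟪a, x⟫ := by
  set f : E →ₗ[ℝ] ℝ := (innerSL ℝ a).toLinearMap with hf
  have hfs : LinearMap.range f = ⊤ := by
    refine LinearMap.range_eq_top.2 (LinearMap.surjective fun h => ha ?_)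
    have : f a = 0 := by rw [h]; rfl
    simpa [hf] using this
  obtain ⟨q, hq⟩ := f.ker.exists_isCompl
  have hker : finrank ℝ f.ker = d := by
    have := f.finrank_range_add_finrank_ker
    rw [hfs, finrank_top, finrank_self, hd] at this
    omega
  set e := LinearMap.equivProdOfSurjectiveOfIsCompl f (f.ker.projectionOnto q hq) hfs
    (Submodule.range_projectionOnto hq) (by rw [Submodule.ker_projectionOnto]; exact hq) with he
  set ψ : f.ker ≃ₗ[ℝ] (Fin d → ℝ) := LinearEquiv.ofFinrankEq _ _ (by simp [hker])
  refine ⟨(e.trans ((LinearEquiv.refl ℝ ℝ).prodCongr ψ)).toContinuousLinearEquiv, fun x => ?_⟩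
  simp [he, hf]

variable [MeasurableSpace E] [BorelSpace E]

theorem exists_affineEquiv_fst_eq {d : ℕ} (hd : finrank ℝ E = d + 1) {a : E} (ha : a ≠ 0) :
    ∃ Φ : E ≃ᵃ[ℝ] ℝ × (Fin d → ℝ), ∃ c : ℝ, Continuous Φ ∧ Continuous Φ.symm ∧ 0 < c ∧
      (∀ x, (Φ x).1 = 1 - ⟪a, x⟫) ∧ (∀ S, volume.real S = c * volume.real (Φ '' S)) ∧
      ∀ S, ∀ g : ℝ × (Fin d → ℝ) → ℝ, ∫ x in S, g (Φ x) = c * ∫ x in Φ '' S, g x := by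
  obtain ⟨φ, hφ⟩ := exists_continuousLinearEquiv_fst_eq_inner hd (neg_ne_zero.2 ha)
  have hX : (volume : Measure (ℝ × (Fin d → ℝ))).IsAddHaarMeasure := by
    rw [Measure.volume_eq_prod]; infer_instance
  set v : ℝ × (Fin d → ℝ) := (1, 0)
  set Φ : E ≃ᵃ[ℝ] ℝ × (Fin d → ℝ) :=
    φ.toLinearEquiv.toAffineEquiv.trans (AffineEquiv.constVAdd ℝ _ v) with hΦ
  have hΦa : ∀ x, Φ x = v + φ x := fun x => rfl
  have hc1 : Continuous Φ := by
    have : (Φ : E → _) = fun x => v + φ x := rfl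
    rw [this]; fun_prop
  have hc2 : Continuous Φ.symm := by
    have : (Φ.symm : _ → E) = fun x => φ.symm (-v + x) := rfl
    rw [this]; fun_prop
  set e : E ≃ᵐ ℝ × (Fin d → ℝ) := (Homeomorph.mk Φ.toEquiv hc1 hc2).toMeasurableEquiv
  have hea : ∀ x, e x = Φ x := fun x => rfl
  set ν := Measure.map φ (volume : Measure E) with hν
  set κ := ν.addHaarScalarFactor volume
  have hκ : ν = κ • volume := Measure.isAddLeftInvariant_eq_smul _ _
  have hκ0 : 0 < κ := by
    have := Measure.addHaarScalarFactor_pos_of_isAddHaarMeasure ν volume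
    exact this
  have hmap : Measure.map e volume = κ • (volume : Measure (ℝ × (Fin d → ℝ))) := by
    rw [← hκ]
    have : (e : E → _) = (fun x => v + x) ∘ φ := rfl
    rw [this, ← Measure.map_map (by fun_prop) φ.continuous.measurable, map_add_left_eq_self]
  have hpre : ∀ S, e ⁻¹' (Φ '' S) = S := fun S => Set.preimage_image_eq S Φ.injective
  refine ⟨Φ, κ, hc1, hc2, by exact_mod_cast hκ0, fun x => ?_, fun S => ?_, fun S g => ?_⟩
  · rw [hΦa, Prod.fst_add, hφ]
    simp [v, sub_eq_add_neg]
  · have := e.map_apply (μ := volume) (Φ '' S)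
    rw [hpre, hmap] at this
    rw [measureReal_def, ← this, measureReal_def]
    simp
  · have := setIntegral_map_equiv (μ := volume) e g (Φ '' S)
    rw [hpre, hmap, Measure.restrict_smul, integral_smul_nnreal_measure] at this
    exact this.symm

theorem exists_coordinates_of_facet {d : ℕ} (hd : finrank ℝ E = d + 1) {a : E} (ha : a ≠ 0)
    {P : Set E} (hPc : IsCompact P) (hP : Convex ℝ P)
    (hF : (P ∩ {x | ⟪a, x⟫ = 1}).Nonempty) :
    ∃ Φ : E ≃ᵃ[ℝ] ℝ × (Fin d → ℝ), ∃ c : ℝ, Continuous Φ ∧ Continuous Φ.symm ∧ 0 < c ∧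
      (∀ x, (Φ x).1 = 1 - ⟪a, x⟫) ∧ (∀ S, volume.real S = c * volume.real (Φ '' S)) ∧
      (∫ x in P, (1 - ⟪a, x⟫) = c * ∫ x in Φ '' P, x.1) ∧
      Φ '' (P ∩ {x | ⟪a, x⟫ = 1}) = {0} ×ˢ (Prod.mk 0 ⁻¹' (Φ '' P)) ∧
      IsCompact (Prod.mk 0 ⁻¹' (Φ '' P)) ∧ Convex ℝ (Prod.mk 0 ⁻¹' (Φ '' P)) ∧
      (Prod.mk 0 ⁻¹' (Φ '' P)).Nonempty ∧
      volume.real (convexHull ℝ ({0} ∪ (P ∩ {x | ⟪a, x⟫ = 1}))) =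
        c * (volume.real (Prod.mk 0 ⁻¹' (Φ '' P)) / (d + 1)) := by
  obtain ⟨Φ, c, hc1, hc2, hc, hΦ, hvol, hmean⟩ := exists_affineEquiv_fst_eq hd ha
  have hKc : IsCompact (Φ '' P) := hPc.image hc1
  have hK : Convex ℝ (Φ '' P) := hP.affine_image Φ.toAffineMap
  have hFB : Φ '' (P ∩ {x | ⟪a, x⟫ = 1}) = {0} ×ˢ (Prod.mk 0 ⁻¹' (Φ '' P)) := by
    ext ⟨t, w⟩
    simp only [Set.mem_image, Set.mem_inter_iff, Set.mem_prod, Set.mem_singleton_iff,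
      Set.mem_preimage, Set.mem_ofPred_eq]
    constructor
    · rintro ⟨x, ⟨hx, hx1⟩, hxe⟩
      have : t = 0 := by
        have := hΦ x
        rw [hxe, hx1] at this
        simpa using this
      subst this
      exact ⟨rfl, x, hx, hxe⟩
    · rintro ⟨rfl, x, hx, hxe⟩
      refine ⟨x, ⟨hx, ?_⟩, hxe⟩
      have := hΦ x
      rw [hxe] at this
      simp only at this
      linarith
  have hBc : IsCompact (Prod.mk 0 ⁻¹' (Φ '' P)) :=
    (hKc.image continuous_snd).of_isClosed_subset
      (hKc.isClosed.preimage (by fun_prop)) fun w hw => ⟨_, hw, rfl⟩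
  have hBconv : Convex ℝ (Prod.mk 0 ⁻¹' (Φ '' P)) := by
    intro x hx y hy p q hp hq hpq
    have := hK hx hy hp hq hpq
    simpa using this
  have hBn : (Prod.mk 0 ⁻¹' (Φ '' P)).Nonempty := by
    have := hF.image Φ
    rw [hFB] at this
    exact this.snd
  refine ⟨Φ, c, hc1, hc2, hc, hΦ, hvol, ?_, hFB, hBc, hBconv, hBn, ?_⟩
  · rw [← hmean P fun x => x.1]
    simp only [hΦ]
  · have h0 : (Φ 0).1 = 1 := by simp [hΦ]
    have h1 : Φ '' convexHull ℝ ({0} ∪ (P ∩ {x | ⟪a, x⟫ = 1})) =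
        convexHull ℝ (insert (Φ 0) ({0} ×ˢ (Prod.mk 0 ⁻¹' (Φ '' P)))) := by
      rw [← hFB, ← Set.image_insert_eq]
      exact Φ.toAffineMap.image_convexHull _
    rw [hvol, h1, volume_pyramid hBconv hBc hBn (by rw [h0]; exact one_pos), h0, mul_one]

theorem integral_one_sub_inner {a : E} {P : Set E} (hPc : IsCompact P)
    (hcent : ∫ x in P, x = 0) : ∫ x in P, (1 - ⟪a, x⟫) = volume.real P := by
  have hi : IntegrableOn (fun x : E => x) P := continuous_id.continuousOn.integrableOn_compact hPc
  have h1 : ∫ x in P, ⟪a, x⟫ = 0 := by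
    rw [integral_inner hi, hcent, inner_zero_right]
  rw [integral_sub ((continuous_const).continuousOn.integrableOn_compact hPc)
    ((by fun_prop : Continuous fun x : E => ⟪a, x⟫).continuousOn.integrableOn_compact hPc), h1]
  simp

/-- If the cone over a facet of a centered convex body takes at least its maximal possible share
of the volume, then the body is a pyramid over that facet. -/
theorem exists_eq_pyramid_of_volume_le {d : ℕ} (hd : finrank ℝ E = d + 1) {a : E} (ha : a ≠ 0)
    {P : Set E} (hPc : IsCompact P) (hP : Convex ℝ P) (hPi : (interior P).Nonempty)
    (hcent : ∫ x in P, x = 0) (hle : ∀ x ∈ P, ⟪a, x⟫ ≤ 1)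
    (hF : (P ∩ {x | ⟪a, x⟫ = 1}).Nonempty)
    (hvol : volume.real P ≤ (d + 2) * volume.real (convexHull ℝ ({0} ∪ (P ∩ {x | ⟪a, x⟫ = 1})))) :
    ∃ z ∈ P, ⟪a, z⟫ < 1 ∧ P = convexHull ℝ (insert z (P ∩ {x | ⟪a, x⟫ = 1})) := by
  obtain ⟨Φ, c, hc1, hc2, hc, hΦ, hv, hmean, hFB, hBc, hB, hBn, hC⟩ :=
    exists_coordinates_of_facet hd ha hPc hP hF
  have hVpos : 0 < volume.real P := ENNReal.toReal_pos
    (Measure.measure_pos_of_nonempty_interior _ hPi).ne' hPc.measure_lt_top.ne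
  rw [integral_one_sub_inner hPc hcent, hv P] at hmean
  rw [hC, hv P] at hvol
  rw [hv P] at hVpos
  have hvol' : volume.real (Φ '' P) ≤
      (d + 2) * (volume.real (Prod.mk 0 ⁻¹' (Φ '' P)) / (d + 1)) := by
    nlinarith
  obtain ⟨z, ⟨y, hy, rfl⟩, hz, hPz⟩ := exists_eq_pyramid (hPc.image hc1)
    (hP.affine_image Φ.toAffineMap) (by
      have h := hPi.image Φ
      have : Φ '' interior P = interior (Φ '' P) :=
        (Homeomorph.mk Φ.toEquiv hc1 hc2).image_interior P
      rwa [this] at h) (by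
      rintro _ ⟨x, hx, rfl⟩
      rw [hΦ]
      linarith [hle x hx]) (by
      by_contra! h
      have h3 : volume.real (Prod.mk 0 ⁻¹' (Φ '' P)) / (d + 1) ≤ 0 :=
        div_nonpos_of_nonpos_of_nonneg h (by positivity)
      have h4 := pos_of_mul_pos_right hVpos hc.le
      nlinarith) (mul_left_cancel₀ hc.ne' hmean).symm hvol'
  refine ⟨y, hy, by rw [hΦ] at hz; linarith, ?_⟩
  have h1 : Φ '' convexHull ℝ (insert y (P ∩ {x | ⟪a, x⟫ = 1})) =
      convexHull ℝ (insert (Φ y) ({0} ×ˢ (Prod.mk 0 ⁻¹' (Φ '' P)))) := by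
    rw [← hFB, ← Set.image_insert_eq]
    exact Φ.toAffineMap.image_convexHull _
  exact Φ.injective.image_injective (hPz.trans h1.symm)

/-- In a centered pyramid of dimension `d + 1`, the cone over the base takes the share
`1 / (d + 2)` of the volume. -/
theorem volume_eq_of_eq_pyramid {d : ℕ} (hd : finrank ℝ E = d + 1) {a : E} (ha : a ≠ 0)
    {P : Set E} (hPc : IsCompact P) (hP : Convex ℝ P) (hPi : (interior P).Nonempty)
    (hcent : ∫ x in P, x = 0) (hF : (P ∩ {x | ⟪a, x⟫ = 1}).Nonempty) {z : E} (hz : ⟪a, z⟫ < 1)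
    (hPz : P = convexHull ℝ (insert z (P ∩ {x | ⟪a, x⟫ = 1}))) :
    volume.real P = (d + 2) * volume.real (convexHull ℝ ({0} ∪ (P ∩ {x | ⟪a, x⟫ = 1}))) := by
  obtain ⟨Φ, c, hc1, hc2, hc, hΦ, hv, hmean, hFB, hBc, hB, hBn, hC⟩ :=
    exists_coordinates_of_facet hd ha hPc hP hF
  have hVpos : 0 < volume.real P := ENNReal.toReal_pos
    (Measure.measure_pos_of_nonempty_interior _ hPi).ne' hPc.measure_lt_top.ne
  have hz0 : 0 < (Φ z).1 := by rw [hΦ]; linarith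
  have h1 : Φ '' P = convexHull ℝ (insert (Φ z) ({0} ×ˢ (Prod.mk 0 ⁻¹' (Φ '' P)))) := by
    rw [← hFB, ← Set.image_insert_eq]
    exact (congrArg (Φ '' ·) hPz).trans (Φ.toAffineMap.image_convexHull _)
  rw [integral_one_sub_inner hPc hcent, hv P] at hmean
  have hmean := mul_left_cancel₀ hc.ne' hmean
  rw [hv P] at hVpos
  have e1 : volume.real (Φ '' P) =
      volume.real (Prod.mk 0 ⁻¹' (Φ '' P)) * (Φ z).1 / (d + 1) := by
    conv_lhs => rw [h1]
    exact volume_pyramid hB hBc hBn hz0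
  have e2 : ∫ x in Φ '' P, x.1 =
      volume.real (Prod.mk 0 ⁻¹' (Φ '' P)) * (Φ z).1 ^ 2 / ((d + 1) * (d + 2)) := by
    conv_lhs => rw [h1]
    exact integral_fst_pyramid hB hBc hBn hz0
  have h4 := pos_of_mul_pos_right hVpos hc.le
  have hh : (Φ z).1 = d + 2 := by
    have h5 : volume.real (Φ '' P) = volume.real (Φ '' P) * ((Φ z).1 / (d + 2)) := by
      conv_lhs => rw [hmean, e2]
      rw [e1]
      field_simp
    have h6 : (Φ z).1 / (d + 2) = 1 := by
      have := mul_left_cancel₀ h4.ne' (h5.symm.trans (mul_one _).symm)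
      exact this
    rwa [div_eq_one_iff_eq (by positivity)] at h6
  rw [hC, hv P, e1, hh]
  ring

end Transfer

end PrekopaLeindlerAndPyramids

/-! ### Facets, extreme points and simple polytopes -/

section Polytope

variable {E ι : Type*} [NormedAddCommGroup E] [InnerProductSpace ℝ E]
  {a : ι → E} {P F : Set E}

lemma exists_pos_forall_add_smul_mem [Finite ι] (hP : ∀ x, x ∈ P ↔ ∀ i, ⟪a i, x⟫ ≤ 1) {v d : E}
    (h : ∀ i, ⟪a i, v⟫ < 1 ∨ (⟪a i, v⟫ = 1 ∧ ⟪a i, d⟫ = 0)) :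
    ∃ ε > 0, ∀ t : ℝ, |t| ≤ ε → v + t • d ∈ P := by
  have key : ∀ i, ∀ᶠ t : ℝ in nhds 0, ⟪a i, v + t • d⟫ ≤ 1 := fun i ↦ by
    rcases h i with h | ⟨h, h'⟩
    · have hc : Continuous fun t : ℝ ↦ ⟪a i, v + t • d⟫ := by fun_prop
      have := hc.continuousAt.eventually_lt (continuousAt_const (x := (0 : ℝ)) (y := (1 : ℝ)))
        (by simpa using h)
      exact this.mono fun _ ↦ le_of_lt
    · exact .of_forall fun t ↦ by simp [inner_add_right, inner_smul_right, h, h']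
  obtain ⟨ε, hε, hb⟩ := Metric.eventually_nhds_iff.1 (Filter.eventually_all.2 key)
  refine ⟨ε / 2, by positivity, fun t ht ↦ (hP _).2 (hb ?_)⟩
  rw [Real.dist_eq, sub_zero]
  linarith

lemma convex_of_mem_iff (hP : ∀ x, x ∈ P ↔ ∀ i, ⟪a i, x⟫ ≤ 1) : Convex ℝ P := by
  intro x hx y hy s t hs ht hst
  rw [hP] at *
  intro i
  rw [inner_add_right, inner_smul_right, inner_smul_right]
  nlinarith [hx i, hy i]

lemma isClosed_of_mem_iff (hP : ∀ x, x ∈ P ↔ ∀ i, ⟪a i, x⟫ ≤ 1) : IsClosed P := by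
  have : P = ⋂ i, {x | ⟪a i, x⟫ ≤ 1} := by ext x; simp [hP]
  rw [this]
  exact isClosed_iInter fun i ↦ isClosed_le (by fun_prop) continuous_const

lemma exists_mem_facet {i : ι}
    (h : ∃ x, (∀ j, j ≠ i → ⟪a j, x⟫ ≤ 1) ∧ 1 < ⟪a i, x⟫) :
    ∃ w, ⟪a i, w⟫ = 1 ∧ ∀ j, j ≠ i → ⟪a j, w⟫ < 1 := by
  obtain ⟨x, hx, hi⟩ := h
  have hpos : 0 < ⟪a i, x⟫ := by linarith
  refine ⟨(⟪a i, x⟫)⁻¹ • x, ?_, fun j hj ↦ ?_⟩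
  · rw [inner_smul_right, inv_mul_cancel₀ hpos.ne']
  · rw [inner_smul_right, inv_mul_lt_iff₀ hpos, mul_one]
    exact (hx j hj).trans_lt hi

lemma span_tight_eq_top [FiniteDimensional ℝ E] [Finite ι]
    (hP : ∀ x, x ∈ P ↔ ∀ i, ⟪a i, x⟫ ≤ 1) {v : E}
    (hv : v ∈ P.extremePoints ℝ) : Submodule.span ℝ (a '' {i | ⟪a i, v⟫ = 1}) = ⊤ := by
  rw [← Submodule.orthogonal_eq_bot_iff, Submodule.eq_bot_iff]
  intro d hd
  have hd0 : ∀ i, ⟪a i, v⟫ = 1 → ⟪a i, d⟫ = 0 := fun i hi ↦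
    hd _ (Submodule.subset_span ⟨i, hi, rfl⟩)
  obtain ⟨ε, hε, h⟩ := exists_pos_forall_add_smul_mem (v := v) (d := d) hP fun i ↦ by
    rcases ((hP v).1 hv.1 i).lt_or_eq with h | h
    · exact .inl h
    · exact .inr ⟨h, hd0 i h⟩
  have h1 := h ε (abs_of_pos hε).le
  have h2 := h (-ε) (by rw [abs_neg, abs_of_pos hε])
  have := ((mem_extremePoints.1 hv).2 _ h1 _ h2
    ⟨1 / 2, 1 / 2, by norm_num, by norm_num, by norm_num, by module⟩).1
  have h3 : ε • d = 0 := by simpa using this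
  exact (smul_eq_zero.1 h3).resolve_left hε.ne'

lemma linearIndependent_tight [FiniteDimensional ℝ E] [Finite ι]
    (hP : ∀ x, x ∈ P ↔ ∀ i, ⟪a i, x⟫ ≤ 1)
    {v : E} (hv : v ∈ P.extremePoints ℝ)
    (hcard : Nat.card {i | ⟪a i, v⟫ = 1} = finrank ℝ E) :
    LinearIndependent ℝ fun i : {i | ⟪a i, v⟫ = 1} ↦ a i := by
  have := Fintype.ofFinite {i | ⟪a i, v⟫ = 1}
  apply linearIndependent_of_top_le_span_of_card_eq_finrank
  · rw [← span_tight_eq_top hP hv, Set.image_eq_range]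
  · rw [← hcard, Nat.card_eq_fintype_card]

lemma exists_face_subset_facet [FiniteDimensional ℝ E] [Finite ι]
    (hP : ∀ x, x ∈ P ↔ ∀ i, ⟪a i, x⟫ ≤ 1)
    (hPi : (interior P).Nonempty) (hF : IsExtreme ℝ P F) (hFconv : Convex ℝ F)
    (hFne : F.Nonempty) (hdim : finrank ℝ (affineSpan ℝ F).direction < finrank ℝ E) :
    ∃ i, F ⊆ {x | ⟪a i, x⟫ = 1} := by
  by_contra! hcon
  have := Fintype.ofFinite ι
  have hx : ∀ i, ∃ x ∈ F, ⟪a i, x⟫ < 1 := fun i ↦ by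
    obtain ⟨x, hx, hxi⟩ := Set.not_subset.1 (hcon i)
    exact ⟨x, hx, ((hP x).1 (hF.1 hx) i).lt_of_ne hxi⟩
  choose x hxF hxi using hx
  obtain ⟨x0, hx0, hlt⟩ : ∃ x0 ∈ F, ∀ i, ⟪a i, x0⟫ < 1 := by
    rcases isEmpty_or_nonempty ι with hι | hι
    · exact ⟨hFne.some, hFne.some_mem, fun i ↦ hι.elim i⟩
    have hc : (0 : ℝ) < Fintype.card ι := by exact_mod_cast Fintype.card_pos
    refine ⟨∑ i, (Fintype.card ι : ℝ)⁻¹ • x i,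
      hFconv.sum_mem (fun _ _ ↦ by positivity) ?_ fun i _ ↦ hxF i, fun i ↦ ?_⟩
    · simp [hc.ne']
    · rw [inner_sum]
      simp_rw [inner_smul_right]
      rw [← Finset.mul_sum, inv_mul_lt_iff₀ hc, mul_one]
      calc ∑ j, ⟪a i, x j⟫ < ∑ _j : ι, (1 : ℝ) :=
            Finset.sum_lt_sum (fun j _ ↦ (hP _).1 (hF.1 (hxF j)) i) ⟨i, Finset.mem_univ _, hxi i⟩
        _ = Fintype.card ι := by simp
  have hFP : F = P := hF.1.antisymm fun p hp ↦ by
    obtain ⟨ε, hε, h⟩ := exists_pos_forall_add_smul_mem (v := x0) (d := x0 - p) hP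
      fun i ↦ .inl (hlt i)
    refine hF.left_mem_of_mem_openSegment hp (h ε (abs_of_pos hε).le) hx0
      ⟨ε / (1 + ε), 1 / (1 + ε), by positivity, by positivity, by field_simp; ring, ?_⟩
    match_scalars <;> field_simp
    ring
  have hs : affineSpan ℝ F = ⊤ := by
    rw [hFP, eq_top_iff, ← isOpen_interior.affineSpan_eq_top hPi]
    exact affineSpan_mono ℝ interior_subset
  rw [hs, AffineSubspace.direction_top, finrank_top] at hdim
  exact hdim.false

lemma affineIndependent_of_face [FiniteDimensional ℝ E] [Finite ι]
    (hP : ∀ x, x ∈ P ↔ ∀ i, ⟪a i, x⟫ ≤ 1)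
    (hPc : IsCompact P)
    (hsimple : ∀ v ∈ P.extremePoints ℝ, Nat.card {i | ⟪a i, v⟫ = 1} = finrank ℝ E)
    (hFP : F ⊆ P) (hFne : F.Nonempty) :
    AffineIndependent ℝ fun i : {i | F ⊆ {x | ⟪a i, x⟫ = 1}} ↦ a i := by
  set I := {i | F ⊆ {x | ⟪a i, x⟫ = 1}}
  set G := P ∩ {x | ∀ i ∈ I, ⟪a i, x⟫ = 1} with hG
  have hGe : IsExtreme ℝ P G := by
    refine ⟨Set.inter_subset_left, fun x hx y hy z hz hzs ↦ ⟨hx, fun i hi ↦ ?_⟩⟩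
    obtain ⟨s, t, hs, ht, hst, rfl⟩ := hzs
    have h1 := hz.2 i hi
    rw [inner_add_right, inner_smul_right, inner_smul_right] at h1
    have h2 := (hP x).1 hx i
    have h3 := (hP y).1 hy i
    refine h2.antisymm ?_
    by_contra! h4
    nlinarith
  have hGc : IsCompact G := by
    refine hPc.inter_right ?_
    have : {x | ∀ i ∈ I, ⟪a i, x⟫ = 1} = ⋂ i ∈ I, {x | ⟪a i, x⟫ = 1} := by ext; simp
    rw [this]
    exact isClosed_biInter fun i _ ↦ isClosed_eq (by fun_prop) continuous_const
  obtain ⟨x, hx⟩ := hFne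
  obtain ⟨v, hv⟩ := hGc.extremePoints_nonempty ⟨x, hFP hx, fun i hi ↦ hi hx⟩
  have hvP := hGe.extremePoints_subset_extremePoints hv
  have hli := linearIndependent_tight hP hvP (hsimple v hvP)
  exact (hli.comp (Set.inclusion fun i hi ↦ hv.1.2 i hi)
    (Set.inclusion_injective _)).affineIndependent

lemma mem_affineSpan_normals_iff {i : ι} :
    a i ∈ affineSpan ℝ (a '' {i | F ⊆ {x | ⟪a i, x⟫ = 1}}) ↔ F ⊆ {x | ⟪a i, x⟫ = 1} := by
  refine ⟨fun h x hx ↦ ?_, fun h ↦ subset_affineSpan ℝ _ ⟨i, h, rfl⟩⟩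
  refine affineSpan_induction (p := fun y ↦ ⟪y, x⟫ = 1) h ?_ fun c u v w hu hv hw ↦ ?_
  · rintro _ ⟨j, hj, rfl⟩
    exact hj hx
  · simp [inner_add_left, inner_sub_left, inner_smul_left, hu, hv, hw]

lemma exists_mem_segment_of_mem_pyramid (hP : ∀ x, x ∈ P ↔ ∀ i, ⟪a i, x⟫ ≤ 1) {i : ι} {z w : E}
    (hw : w ∈ P ∩ {x | ⟪a i, x⟫ = 1})
    (hPz : P = convexHull ℝ (insert z (P ∩ {x | ⟪a i, x⟫ = 1}))) {x : E} (hx : x ∈ P) :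
    ∃ y ∈ P ∩ {x | ⟪a i, x⟫ = 1}, ∃ t : ℝ, 0 ≤ t ∧ t ≤ 1 ∧ x = (1 - t) • z + t • y := by
  have hconv : Convex ℝ (P ∩ {x | ⟪a i, x⟫ = 1}) :=
    (convex_of_mem_iff hP).inter (convex_hyperplane (innerₛₗ ℝ (a i)).isLinear 1)
  rw [hPz, convexHull_insert ⟨w, hw⟩, hconv.convexHull_eq, convexJoin_singleton_left] at hx
  obtain ⟨y, hy, hxy⟩ := Set.mem_iUnion₂.1 hx
  obtain ⟨t, ⟨h0, h1⟩, rfl⟩ := (segment_eq_image ℝ z y) ▸ hxy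
  exact ⟨y, hy, t, h0, h1, rfl⟩

lemma apex_mem_extremePoints (hP : ∀ x, x ∈ P ↔ ∀ i, ⟪a i, x⟫ ≤ 1) {i : ι} {z w : E}
    (hw : w ∈ P ∩ {x | ⟪a i, x⟫ = 1}) (hz : z ∈ P) (hzi : ⟪a i, z⟫ < 1)
    (hPz : P = convexHull ℝ (insert z (P ∩ {x | ⟪a i, x⟫ = 1}))) : z ∈ P.extremePoints ℝ := by
  have key : ∀ x ∈ P, ⟪a i, z⟫ ≤ ⟪a i, x⟫ ∧ (⟪a i, x⟫ = ⟪a i, z⟫ → x = z) := fun x hx ↦ by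
    obtain ⟨y, hy, t, h0, h1, rfl⟩ := exists_mem_segment_of_mem_pyramid hP hw hPz hx
    have hyi : ⟪a i, y⟫ = 1 := hy.2
    have e : ⟪a i, (1 - t) • z + t • y⟫ = ⟪a i, z⟫ + t * (1 - ⟪a i, z⟫) := by
      rw [inner_add_right, inner_smul_right, inner_smul_right, hyi]; ring
    rw [e]
    refine ⟨by nlinarith, fun h ↦ ?_⟩
    have ht : t = 0 := by
      rcases mul_eq_zero.1 (add_eq_left.1 h) with h | h
      · exact h
      · linarith
    simp [ht]
  refine mem_extremePoints_iff_left.2 ⟨hz, fun x hx y hy hzs ↦ ?_⟩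
  obtain ⟨s, t, hs, ht, hst, e⟩ := hzs
  have e' : s * ⟪a i, x⟫ + t * ⟪a i, y⟫ = ⟪a i, z⟫ := by
    rw [← inner_smul_right, ← inner_smul_right, ← inner_add_right, e]
  refine (key x hx).2 ((key x hx).1.antisymm' ?_)
  by_contra! h
  nlinarith [(key y hy).1]

lemma inner_apex_eq_one (hP : ∀ x, x ∈ P ↔ ∀ i, ⟪a i, x⟫ ≤ 1) {i j : ι} {z w w' : E}
    (hw : w ∈ P ∩ {x | ⟪a i, x⟫ = 1}) (hz : z ∈ P)
    (hPz : P = convexHull ℝ (insert z (P ∩ {x | ⟪a i, x⟫ = 1})))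
    (hw' : w' ∈ P) (hj : ⟪a j, w'⟫ = 1) (hi : ⟪a i, w'⟫ < 1) : ⟪a j, z⟫ = 1 := by
  obtain ⟨y, hy, t, h0, h1, rfl⟩ := exists_mem_segment_of_mem_pyramid hP hw hPz hw'
  have hyi : ⟪a i, y⟫ = 1 := hy.2
  have hyj := (hP y).1 hy.1 j
  have hzj := (hP z).1 hz j
  rw [inner_add_right, inner_smul_right, inner_smul_right] at hi hj
  rcases h1.eq_or_lt with rfl | h1
  · simp [hyi] at hi
  · refine hzj.antisymm ?_
    by_contra! h
    nlinarith

lemma exists_simplex_of_card [FiniteDimensional ℝ E] [Finite ι]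
    (hP : ∀ x, x ∈ P ↔ ∀ i, ⟪a i, x⟫ ≤ 1) (hPc : IsCompact P) (hPi : (interior P).Nonempty)
    (hsimple : ∀ v ∈ P.extremePoints ℝ, Nat.card {i | ⟪a i, v⟫ = 1} = finrank ℝ E)
    (hι : Nat.card ι = finrank ℝ E + 1) :
    ∃ pts : Fin (finrank ℝ E + 1) → E,
      AffineIndependent ℝ pts ∧ P = convexHull ℝ (Set.range pts) := by
  set S := P.extremePoints ℝ
  have hidx : ∀ v : S, ∃ i, ∀ j, ⟪a j, (v : E)⟫ = 1 ↔ j ≠ i := fun v ↦ by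
    have h1 := Set.ncard_add_ncard_compl {i | ⟪a i, (v : E)⟫ = 1}
    have h2 : Set.ncard {i | ⟪a i, (v : E)⟫ = 1} = _ := hsimple v v.2
    rw [h2, hι] at h1
    obtain ⟨i, hi⟩ := Set.ncard_eq_one.1 (Nat.add_left_cancel h1)
    refine ⟨i, fun j ↦ ?_⟩
    have : j ∈ {i | ⟪a i, (v : E)⟫ = 1}ᶜ ↔ j ∈ ({i} : Set ι) := by rw [hi]
    simpa using not_congr this
  choose f hf using hidx
  have hinj : Function.Injective f := fun u v huv ↦ by
    have h : (u : E) - v ∈ (Submodule.span ℝ (a '' {i | ⟪a i, (u : E)⟫ = 1}))ᗮ := by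
      rw [Submodule.mem_orthogonal]
      intro y hy
      induction hy using Submodule.span_induction with
      | mem y hy =>
        obtain ⟨i, hi, rfl⟩ := hy
        have h1 := hi
        rw [Set.mem_ofPred_eq, hf u, huv, ← hf v] at h1
        rw [Set.mem_ofPred_eq] at hi
        rw [inner_sub_right, h1, hi, sub_self]
      | zero => simp
      | add x y _ _ hx hy => rw [inner_add_left, hx, hy, add_zero]
      | smul c x _ hx => rw [inner_smul_left, hx, mul_zero]
    rw [span_tight_eq_top hP u.2, Submodule.top_orthogonal_eq_bot, Submodule.mem_bot,
      sub_eq_zero] at h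
    exact Subtype.ext h
  have hfin : Finite S := Finite.of_injective f hinj
  have hle : Nat.card S ≤ finrank ℝ E + 1 := hι ▸ Nat.card_le_card_of_injective f hinj
  have hhull : convexHull ℝ S = P := by
    rw [← closure_convexHull_extremePoints hPc (convex_of_mem_iff hP)]
    exact ((Set.toFinite S).isClosed_convexHull ℝ).closure_eq.symm
  have hspan : affineSpan ℝ S = ⊤ := by
    rw [← affineSpan_convexHull, hhull, eq_top_iff, ← isOpen_interior.affineSpan_eq_top hPi]
    exact affineSpan_mono ℝ interior_subset
  have := Fintype.ofFinite S
  have hrank : finrank ℝ (vectorSpan ℝ (Set.range ((↑) : S → E))) = finrank ℝ E := by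
    rw [Subtype.range_coe, ← direction_affineSpan, hspan, AffineSubspace.direction_top, finrank_top]
  have hne : S.Nonempty := by
    rw [Set.nonempty_iff_ne_empty]
    intro h
    rw [h, convexHull_empty] at hhull
    simp [← hhull] at hPi
  have hge : finrank ℝ E + 1 ≤ Nat.card S := by
    have h1 := hne.to_subtype
    obtain ⟨q, hq⟩ : ∃ q, Fintype.card S = q + 1 :=
      ⟨_, (Nat.succ_pred Fintype.card_ne_zero).symm⟩
    have := finrank_vectorSpan_range_le ℝ ((↑) : S → E) hq
    rw [Nat.card_eq_fintype_card]
    omega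
  let e : Fin (finrank ℝ E + 1) ≃ S := (Finite.equivFinOfCardEq (hle.antisymm hge)).symm
  refine ⟨fun i ↦ e i, ?_, ?_⟩
  · refine AffineIndependent.comp_embedding e.toEmbedding ?_
    rw [affineIndependent_iff_finrank_vectorSpan_eq ℝ _ (n := finrank ℝ E), hrank]
    rw [← Nat.card_eq_fintype_card]
    exact hle.antisymm hge
  · rw [← hhull]
    congr 1
    ext x
    exact ⟨fun hx ↦ ⟨e.symm ⟨x, hx⟩, by simp⟩, by rintro ⟨i, rfl⟩; exact (e i).2⟩

lemma exists_apex_of_simplex [Finite ι] {κ : Type*} [Fintype κ]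
    (hP : ∀ x, x ∈ P ↔ ∀ i, ⟪a i, x⟫ ≤ 1) (h0 : (0 : E) ∈ P) (b : AffineBasis κ ℝ E)
    (hPb : P = convexHull ℝ (Set.range b)) {i : ι} {w : E} (hw : ⟪a i, w⟫ = 1)
    (hw' : ∀ j, j ≠ i → ⟪a j, w⟫ < 1) :
    ∃ z, ⟪a i, z⟫ < 1 ∧ P = convexHull ℝ (insert z (P ∩ {x | ⟪a i, x⟫ = 1})) := by
  classical
  have hbP : ∀ j, b j ∈ P := fun j ↦ hPb ▸ subset_convexHull ℝ _ ⟨j, rfl⟩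
  have hcoord : ∀ x, x ∈ P ↔ ∀ j, 0 ≤ b.coord j x := fun x ↦ by
    rw [hPb, b.convexHull_eq_nonneg_coord]; rfl
  have hwP : w ∈ P := (hP w).2 fun j ↦ by
    rcases eq_or_ne j i with rfl | h
    · exact hw.le
    · exact (hw' j h).le
  obtain ⟨j₀, hj₀⟩ : ∃ j, ⟪a i, b j⟫ < 1 := by
    by_contra! h
    have hsub : P ⊆ {x | 1 ≤ ⟪a i, x⟫} := by
      rw [hPb]
      refine convexHull_min ?_ (convex_halfSpace_ge (innerₛₗ ℝ (a i)).isLinear 1)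
      rintro _ ⟨j, rfl⟩
      exact h j
    have := hsub h0
    simp only [Set.mem_ofPred_eq, inner_zero_right] at this
    linarith
  have hzero : ∀ j, ⟪a i, b j⟫ < 1 → b.coord j w = 0 := by
    have hsum : ∑ j, b.coord j w * (1 - ⟪a i, b j⟫) = 0 := by
      have h1 := congrArg (fun x ↦ ⟪a i, x⟫) (b.linear_combination_coord_eq_self w)
      simp only [inner_sum, inner_smul_right, hw] at h1
      simp_rw [mul_sub, mul_one]
      rw [Finset.sum_sub_distrib, h1, b.sum_coord_apply_eq_one, sub_self]
    have hnn := (Finset.sum_eq_zero_iff_of_nonneg fun j _ ↦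
      mul_nonneg ((hcoord w).1 hwP j) (sub_nonneg.2 ((hP _).1 (hbP j) i))).1 hsum
    intro j hj
    rcases mul_eq_zero.1 (hnn j (Finset.mem_univ j)) with h | h
    · exact h
    · linarith
  have huniq : ∀ j, j ≠ j₀ → ⟪a i, b j⟫ = 1 := by
    intro j hj
    by_contra hne
    have hj1 : ⟪a i, b j⟫ < 1 := ((hP _).1 (hbP j) i).lt_of_ne hne
    set d := (1 - ⟪a i, b j⟫) • (b j₀ - w) - (1 - ⟪a i, b j₀⟫) • (b j - w) with hd
    have hdi : ⟪a i, d⟫ = 0 := by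
      simp only [hd, inner_sub_right, inner_smul_right, hw]; ring
    obtain ⟨ε, hε, h⟩ := exists_pos_forall_add_smul_mem (v := w) (d := d) hP fun l ↦ by
      rcases eq_or_ne l i with rfl | hl
      · exact .inr ⟨hw, hdi⟩
      · exact .inl (hw' l hl)
    have h1 := (hcoord _).1 (h ε (abs_of_pos hε).le) j
    have hlin : ∀ x, (b.coord j).linear (x - w) = b.coord j x := fun x ↦ by
      rw [← vsub_eq_sub, AffineMap.linearMap_vsub, hzero j hj1, vsub_eq_sub, sub_zero]
    rw [add_comm, ← vadd_eq_add, AffineMap.map_vadd, hzero j hj1, map_smul, hd, map_sub,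
      map_smul, map_smul, hlin, hlin, b.coord_apply_ne hj, b.coord_apply_eq] at h1
    simp only [smul_eq_mul, vadd_eq_add, mul_zero, zero_sub, mul_one, add_zero] at h1
    nlinarith
  refine ⟨b j₀, hj₀, Set.Subset.antisymm ?_
    (convexHull_min (Set.insert_subset (hbP j₀) Set.inter_subset_left) (convex_of_mem_iff hP))⟩
  nth_rw 1 [hPb]
  refine convexHull_mono ?_
  rintro _ ⟨j, rfl⟩
  rcases eq_or_ne j j₀ with rfl | hj
  · exact Set.mem_insert _ _
  · exact Set.mem_insert_of_mem _ ⟨hbP j, huniq j hj⟩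

end Polytope

open Classical in
/-- For a centered simple `n`-dimensional polytope `P = {x | ⟪a i, x⟫ ≤ 1}`
(irredundant description, `0 ∈ int P`), a `k`-face `F` of `P` with
`1 ≤ k ≤ n-1`, and `A` the affine span of the normal vectors `a i` of the
facets containing `F`, equality holds in the affine subspace concentration
inequality for `A` if and only if `P` is a centered simplex. -/
theorem equality_case_simple_polytope
    (n m : ℕ) (a : Fin m → EuclideanSpace ℝ (Fin n))
    (P : Set (EuclideanSpace ℝ (Fin n)))
    (hP : P = {x | ∀ i, ⟪a i, x⟫ ≤ 1})
    (hbd : Bornology.IsBounded P)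
    (h0 : (0 : EuclideanSpace ℝ (Fin n)) ∈ interior P)
    (hinj : Function.Injective a)
    (ha0 : ∀ i, a i ≠ 0)
    (hirr : ∀ i, ∃ x, (∀ j, j ≠ i → ⟪a j, x⟫ ≤ 1) ∧ 1 < ⟪a i, x⟫)
    (hcent : (volume P).toReal⁻¹ • (∫ x in P, x) = 0)
    (hsimple : ∀ v ∈ Set.extremePoints ℝ P,
      (Finset.univ.filter (fun i => ⟪a i, v⟫ = 1)).card = n)
    (F : Set (EuclideanSpace ℝ (Fin n))) (k : ℕ)
    (hF : IsExtreme ℝ P F) (hFconv : Convex ℝ F) (hFne : F.Nonempty)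
    (hk1 : 1 ≤ k) (hk2 : k ≤ n - 1)
    (hFdim : finrank ℝ (affineSpan ℝ F).direction = k)
    (A : AffineSubspace ℝ (EuclideanSpace ℝ (Fin n)))
    (hA : A = affineSpan ℝ (a '' {i | F ⊆ P ∩ {x | ⟪a i, x⟫ = 1}})) :
    (∑ i ∈ Finset.univ.filter (fun i => a i ∈ A),
        (volume (convexHull ℝ ({0} ∪ (P ∩ {x | ⟪a i, x⟫ = 1})))).toReal
        = ((finrank ℝ A.direction + 1 : ℝ) / (n + 1)) * (volume P).toReal) ↔
      ((∃ pts : Fin (n + 1) → EuclideanSpace ℝ (Fin n),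
          AffineIndependent ℝ pts ∧ P = convexHull ℝ (Set.range pts)) ∧
        (volume P).toReal⁻¹ • (∫ x in P, x) = 0) := by
  have hPm : ∀ x, x ∈ P ↔ ∀ i, ⟪a i, x⟫ ≤ 1 := fun x ↦ by rw [hP]; rfl
  have hPi : (interior P).Nonempty := ⟨0, h0⟩
  have hPconv := convex_of_mem_iff hPm
  have hPc : IsCompact P := Metric.isCompact_of_isClosed_isBounded (isClosed_of_mem_iff hPm) hbd
  have hVpos : 0 < volume.real P := ENNReal.toReal_pos
    (Measure.measure_pos_of_nonempty_interior _ hPi).ne' hPc.measure_lt_top.ne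
  have hc : ∫ x in P, x = 0 := (smul_eq_zero.1 hcent).resolve_left (inv_pos.2 hVpos).ne'
  have hfr : finrank ℝ (EuclideanSpace ℝ (Fin n)) = n := by simp
  obtain ⟨d, rfl⟩ : ∃ d, n = d + 1 := ⟨n - 1, by omega⟩
  have hsimple' : ∀ v ∈ P.extremePoints ℝ, Nat.card {i | ⟪a i, v⟫ = 1} =
      finrank ℝ (EuclideanSpace ℝ (Fin (d + 1))) := fun v hv ↦ by
    rw [hfr]
    refine Eq.trans ?_ (hsimple v hv)
    exact Nat.subtype_card _ (by simp)
  have hw : ∀ i, ∃ w, ⟪a i, w⟫ = 1 ∧ ∀ j, j ≠ i → ⟪a j, w⟫ < 1 := fun i ↦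
    exists_mem_facet (hirr i)
  have hwP : ∀ i w, ⟪a i, w⟫ = 1 → (∀ j, j ≠ i → ⟪a j, w⟫ < 1) → w ∈ P := fun i w h h' ↦
    (hPm w).2 fun j ↦ by
      rcases eq_or_ne j i with rfl | hj
      · exact h.le
      · exact (h' j hj).le
  have hFn : ∀ i, (P ∩ {x | ⟪a i, x⟫ = 1}).Nonempty := fun i ↦ by
    obtain ⟨w, h, h'⟩ := hw i
    exact ⟨w, hwP i w h h', h⟩
  set I := {i | F ⊆ {x | ⟪a i, x⟫ = 1}} with hI
  have hIA : A = affineSpan ℝ (a '' I) := by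
    rw [hA]
    congr! 4 with i
    exact ⟨fun h ↦ h.trans Set.inter_subset_right, fun h ↦ Set.subset_inter hF.1 h⟩
  have hmem : ∀ i, a i ∈ A ↔ i ∈ I := fun i ↦ by rw [hIA]; exact mem_affineSpan_normals_iff
  obtain ⟨i₀, hi₀⟩ := exists_face_subset_facet hPm hPi hF hFconv hFne (by omega)
  have hdim : (finrank ℝ A.direction : ℝ) + 1 =
      (Finset.univ.filter fun i ↦ a i ∈ A).card := by
    have haff : AffineIndependent ℝ fun i : I ↦ a i :=
      affineIndependent_of_face hPm hPc hsimple' hF.1 hFne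
    have hcard : (Finset.univ.filter fun i ↦ a i ∈ A).card = Fintype.card I := by
      rw [Fintype.card_subtype]
      simp_rw [hmem]
    have hne : Nonempty I := ⟨⟨i₀, hi₀⟩⟩
    obtain ⟨q, hq⟩ : ∃ q, Fintype.card I = q + 1 :=
      ⟨_, (Nat.succ_pred Fintype.card_ne_zero).symm⟩
    have h1 := haff.finrank_vectorSpan hq
    rw [← Set.image_eq_range, ← direction_affineSpan, ← hIA] at h1
    rw [hcard, hq, h1]
    push_cast
    rfl
  have hmemI : i₀ ∈ Finset.univ.filter fun i ↦ a i ∈ A := by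
    rw [Finset.mem_filter_univ, hmem]
    exact hi₀
  rw [hdim]
  push_cast
  constructor
  · intro hsum
    refine ⟨?_, hcent⟩
    obtain ⟨i, -, hi⟩ : ∃ i ∈ Finset.univ.filter fun i ↦ a i ∈ A,
        volume.real P / (d + 1 + 1) ≤
          volume.real (convexHull ℝ ({0} ∪ (P ∩ {x | ⟪a i, x⟫ = 1}))) := by
      refine Finset.exists_le_of_sum_le ⟨i₀, hmemI⟩ ?_
      simp only [measureReal_def]
      rw [hsum, Finset.sum_const, nsmul_eq_mul]
      exact le_of_eq (by ring)
    obtain ⟨z, hzP, hzi, hPz⟩ := exists_eq_pyramid_of_volume_le hfr (ha0 i) hPc hPconv hPi hc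
      (fun x hx ↦ (hPm x).1 hx i) (hFn i) (by
        rw [div_le_iff₀ (by positivity)] at hi
        linarith)
    obtain ⟨w, hwF⟩ := hFn i
    have hzE := apex_mem_extremePoints hPm hwF hzP hzi hPz
    have htight : {j | ⟪a j, z⟫ = 1} = {i}ᶜ := by
      ext j
      refine ⟨fun h hji ↦ ?_, fun hji ↦ ?_⟩
      · rw [Set.mem_singleton_iff] at hji
        rw [Set.mem_ofPred_eq, hji] at h
        exact hzi.ne h
      · obtain ⟨w', h, h'⟩ := hw j
        exact inner_apex_eq_one hPm hwF hzP hPz (hwP j w' h h') h (h' i fun e ↦ hji e.symm)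
    have hcard : Nat.card (Fin m) = finrank ℝ (EuclideanSpace ℝ (Fin (d + 1))) + 1 := by
      have h1 := Set.ncard_add_ncard_compl {i}
      rw [← htight, Set.ncard_singleton] at h1
      have h2 : Set.ncard {j | ⟪a j, z⟫ = 1} = _ := hsimple' z hzE
      omega
    have := exists_simplex_of_card hPm hPc hPi hsimple' hcard
    rwa [hfr] at this
  · rintro ⟨⟨pts, hpts, hPp⟩, -⟩
    let b : AffineBasis (Fin (d + 1 + 1)) ℝ (EuclideanSpace ℝ (Fin (d + 1))) :=
      ⟨pts, hpts, by
        rw [hpts.affineSpan_eq_top_iff_card_eq_finrank_add_one, hfr, Fintype.card_fin]⟩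
    have hvol : ∀ i, (volume (convexHull ℝ ({0} ∪ (P ∩ {x | ⟪a i, x⟫ = 1})))).toReal =
        (volume P).toReal / (d + 1 + 1) := fun i ↦ by
      obtain ⟨w, h, h'⟩ := hw i
      obtain ⟨z, hz, hPz⟩ := exists_apex_of_simplex hPm (interior_subset h0) b hPp h h'
      have := volume_eq_of_eq_pyramid hfr (ha0 i) hPc hPconv hPi hc (hFn i) hz hPz
      rw [measureReal_def, measureReal_def] at this
      rw [this]
      field_simp
      ring
    rw [Finset.sum_congr rfl fun i _ ↦ hvol i, Finset.sum_const, nsmul_eq_mul]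
    ring
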